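/- Fix real numbers λ > 0, μ > 0, w > 0 and γ > 0. Let 0 < p₁ < p₂ ≤ 1, and let x₁, x₂ ∈ [0, 1/γ) satisfy the policy-(S) equilibrium quadratic equation wγ(λ+μpᵢ)·xᵢ² − (w(λ + μpᵢ + λγ) + λμpᵢ)·xᵢ + λw = 0 for i = 1, 2. Then (μp₁/λ)·x₁ < (μp₂/λ)·x₂; that is, the equilibrium fraction x_I* = (μp/λ)·x_S* of devices in the idle state under policy (S) is strictly increasing in the successful transmission probability p. -/

import Mathlib

/-- The equilibrium quadratic in factored form: the flow into the service state balances
the flow out of it. -/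
lemma equilibrium_balance {lam mu w γ p x : ℝ}
    (hq : w * γ * (lam + mu * p) * x^2
        - (w * (lam + mu * p + lam * γ) + lam * mu * p) * x + lam * w = 0) :
    w * ((1 - γ * x) * (lam - lam * x - mu * p * x)) = lam * (mu * p * x) := by
  linear_combination hq

/-- At equilibrium the service, free-channel and waiting fractions are all positive. -/
lemma equilibrium_pos {lam mu w γ p x : ℝ} (hlam : 0 < lam) (hmu : 0 < mu) (hw : 0 < w)
    (hγ : 0 < γ) (hp : 0 < p) (hx0 : 0 ≤ x) (hx1 : x < 1/γ)
    (hq : w * γ * (lam + mu * p) * x^2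
        - (w * (lam + mu * p + lam * γ) + lam * mu * p) * x + lam * w = 0) :
    0 < x ∧ 0 < 1 - γ * x ∧ 0 < lam - lam * x - mu * p * x := by
  have hx : 0 < x := by
    refine hx0.lt_of_ne ?_
    rintro rfl
    have : 0 < lam * w := by positivity
    linarith
  have hg : 0 < 1 - γ * x := by
    rw [lt_div_iff₀ hγ] at hx1
    linarith
  have hflow : 0 < w * ((1 - γ * x) * (lam - lam * x - mu * p * x)) := by
    rw [equilibrium_balance hq]
    positivity
  exact ⟨hx, hg, pos_of_mul_pos_right (pos_of_mul_pos_right hflow hw.le) hg.le⟩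

theorem stmt13 (lam mu w γ : ℝ) (hlam : 0 < lam) (hmu : 0 < mu) (hw : 0 < w)
    (hγ : 0 < γ)
    (p₁ p₂ x₁ x₂ : ℝ) (hp₁ : 0 < p₁) (hp : p₁ < p₂) (hp₂ : p₂ ≤ 1)
    (hx₁0 : 0 ≤ x₁) (hx₁1 : x₁ < 1/γ)
    (hq₁ : w * γ * (lam + mu * p₁) * x₁^2
        - (w * (lam + mu * p₁ + lam * γ) + lam * mu * p₁) * x₁ + lam * w = 0)
    (hx₂0 : 0 ≤ x₂) (hx₂1 : x₂ < 1/γ)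
    (hq₂ : w * γ * (lam + mu * p₂) * x₂^2
        - (w * (lam + mu * p₂ + lam * γ) + lam * mu * p₂) * x₂ + lam * w = 0) :
    (mu * p₁ / lam) * x₁ < (mu * p₂ / lam) * x₂ := by
  obtain ⟨hx₁, hg₁, hs₁⟩ := equilibrium_pos hlam hmu hw hγ hp₁ hx₁0 hx₁1 hq₁
  have hb₁ := equilibrium_balance hq₁
  have hb₂ := equilibrium_balance hq₂
  rw [div_mul_eq_mul_div, div_mul_eq_mul_div, div_lt_div_iff_of_pos_right hlam]
  by_contra! hle
  have hx : x₂ < x₁ := by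
    by_contra! hx
    have : mu * p₁ * x₁ < mu * p₂ * x₂ :=
      mul_lt_mul (mul_lt_mul_of_pos_left hp hmu) hx hx₁ (mul_pos hmu (hp₁.trans hp)).le
    linarith
  have hg : 1 - γ * x₁ < 1 - γ * x₂ := by gcongr
  have hs : lam - lam * x₁ - mu * p₁ * x₁ < lam - lam * x₂ - mu * p₂ * x₂ := by
    linarith [mul_lt_mul_of_pos_left hx hlam]
  have hprod := mul_lt_mul_of_pos_left (mul_lt_mul'' hg hs hg₁.le hs₁.le) hw
  linarith [mul_le_mul_of_nonneg_left hle hlam.le]
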